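/- arXiv:1906.02320 — 2 statements merged into one kernel-verified Lean document; each statement's English description precedes it below -/
import Mathlib

section
/- Let C ⊂ ℝ² be a planar convex body and r₀ ∈ ∂C a singular point whose tangent angle is {r : (r − r₀, e₁) ≤ 0, (r − r₀, e₂) ≤ 0} with non-collinear unit vectors e₁, e₂, and let e = λ₁e₁ + λ₂e₂ with λ₁ > 0, λ₂ > 0, |e| = 1. Define ν_t on S¹ by ν_t(A) = |{r ∈ S_t regular : n_r ∈ A}| / |B_t|. Then ν_t weakly converges as t → 0⁺ to the two-atom measure ν_* = (sin β / sin(α+β)) δ_{e₁} + (sin α / sin(α+β)) δ_{e₂} = λ₁ δ_{e₁} + λ₂ δ_{e₂}, where α = ∠(e₁, e) and β = ∠(e₂, e). -/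
open MeasureTheory Set Filter Topology
open scoped RealInnerProductSpace ENNReal

noncomputable section

attribute [local instance] Classical.propDecidable

abbrev E2 := EuclideanSpace ℝ (Fin 2)

/-- A planar convex body: a compact convex set in `ℝ²` with nonempty interior. -/
def IsConvexBody2 (C : Set E2) : Prop :=
  IsCompact C ∧ Convex ℝ C ∧ (interior C).Nonempty

/-- The tangent cone to a convex set `C ⊂ ℝ²` at the point `r₀`. -/
def tanCone2 (C : Set E2) (r₀ : E2) : Set E2 :=
  closure {v : E2 | ∃ c : ℝ, ∃ r ∈ C, 0 ≤ c ∧ v = c • (r - r₀)}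

/-- The angle `{v : ⟪v,e₁⟫ ≤ 0, ⟪v,e₂⟫ ≤ 0}` (as a cone of displacements). -/
def angleCone (e₁ e₂ : E2) : Set E2 := {v : E2 | ⟪v, e₁⟫ ≤ 0 ∧ ⟪v, e₂⟫ ≤ 0}

/-- `n` is an outward unit normal of `C` at `r`. -/
def IsOutwardNormalAt2 (C : Set E2) (r n : E2) : Prop :=
  ‖n‖ = 1 ∧ ∀ x ∈ C, ⟪x - r, n⟫ ≤ 0

/-- `r` is a regular boundary point: the outward unit normal exists and is unique. -/
def IsRegularPt2 (C : Set E2) (r : E2) : Prop :=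
  ∃! n : E2, IsOutwardNormalAt2 C r n

/-- The normal map of `C`, sending a boundary point to an outward unit normal
(the unique one at regular points), and junk value `0` elsewhere. -/
def normalMap2 (C : Set E2) (r : E2) : E2 :=
  if h : ∃ n : E2, IsOutwardNormalAt2 C r n then h.choose else 0

/-- `B_t = C ∩ {r : ⟪r - r₀, e⟫ = -t}`. -/
def Bset2 (C : Set E2) (r₀ e : E2) (t : ℝ) : Set E2 :=
  C ∩ {r : E2 | ⟪r - r₀, e⟫ = -t}

/-- `S_t = ∂C ∩ {r : ⟪r - r₀, e⟫ ≥ -t}`. -/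
def Sset2 (C : Set E2) (r₀ e : E2) (t : ℝ) : Set E2 :=
  frontier C ∩ {r : E2 | ⟪r - r₀, e⟫ ≥ -t}

/-- The normalized measure `ν_t` on `S¹` induced by `S_t`, normalized by the length of
the chord `B_t`. -/
def nuT2 (C : Set E2) (r₀ e : E2) (t : ℝ) : Measure E2 :=
  (μH[1] (Bset2 C r₀ e t))⁻¹ •
    Measure.map (normalMap2 C) (μH[1].restrict (Sset2 C r₀ e t ∩ {r : E2 | IsRegularPt2 C r}))

/-- Weak convergence of the family `ν t` to `ν₀` as `t → 0⁺`. -/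
def WeaklyTendsto2 (ν : ℝ → Measure E2) (ν₀ : Measure E2) : Prop :=
  ∀ f : BoundedContinuousFunction E2 ℝ,
    Tendsto (fun t => ∫ x, f x ∂(ν t)) (𝓝[>] (0 : ℝ)) (𝓝 (∫ x, f x ∂ν₀))

structure Fr (e₁ e₂ u₁ u₂ : E2) (d : ℝ) : Prop where
  dpos : 0 < d
  e1 : ‖e₁‖ = 1
  e2 : ‖e₂‖ = 1
  u1 : ‖u₁‖ = 1
  u2 : ‖u₂‖ = 1
  u1e1 : ⟪u₁, e₁⟫ = 0
  u2e2 : ⟪u₂, e₂⟫ = 0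
  u1e2 : ⟪u₁, e₂⟫ = -d
  u2e1 : ⟪u₂, e₁⟫ = -d
  dec : ∀ v : E2, v = (-(⟪v, e₂⟫ / d)) • u₁ + (-(⟪v, e₁⟫ / d)) • u₂
  p1 : ∀ v : E2, ‖v‖ ^ 2 = ⟪v, e₁⟫ ^ 2 + ⟪v, u₁⟫ ^ 2
  p2 : ∀ v : E2, ‖v‖ ^ 2 = ⟪v, e₂⟫ ^ 2 + ⟪v, u₂⟫ ^ 2

lemma Fr.symm {e₁ e₂ u₁ u₂ : E2} {d : ℝ} (h : Fr e₁ e₂ u₁ u₂ d) : Fr e₂ e₁ u₂ u₁ d where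
  dpos := h.dpos
  e1 := h.e2
  e2 := h.e1
  u1 := h.u2
  u2 := h.u1
  u1e1 := h.u2e2
  u2e2 := h.u1e1
  u1e2 := h.u2e1
  u2e1 := h.u1e2
  dec := fun v => by rw [add_comm]; exact h.dec v
  p1 := h.p2
  p2 := h.p1

lemma E2_inner (x y : E2) : ⟪x, y⟫ = x 0 * y 0 + x 1 * y 1 := by
  simp [PiLp.inner_apply, Fin.sum_univ_two]; ring

lemma E2_normsq (x : E2) : ‖x‖ ^ 2 = x 0 ^ 2 + x 1 ^ 2 := by
  rw [EuclideanSpace.real_norm_sq_eq, Fin.sum_univ_two]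

lemma E2_ext (x y : E2) (h0 : x 0 = y 0) (h1 : x 1 = y 1) : x = y := by
  ext i; fin_cases i <;> assumption

lemma norm_one_of_sq (x : E2) (h : ‖x‖ ^ 2 = 1) : ‖x‖ = 1 := by
  have := norm_nonneg x
  nlinarith

lemma exists_frame (e₁ e₂ e : E2) (l₁ l₂ : ℝ) (he₁ : ‖e₁‖ = 1) (he₂ : ‖e₂‖ = 1)
    (hne : e₁ ≠ e₂) (hne' : e₁ ≠ -e₂) (he : e = l₁ • e₁ + l₂ • e₂) (hnorm : ‖e‖ = 1) :
    ∃ (u₁ u₂ : E2) (d : ℝ), Fr e₁ e₂ u₁ u₂ d ∧ ‖l₁ • u₁ - l₂ • u₂‖ = 1 ∧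
      d ^ 2 = 1 - ⟪e₁, e₂⟫ ^ 2 := by
  have a1 : e₁ 0 ^ 2 + e₁ 1 ^ 2 = 1 := by rw [← E2_normsq, he₁]; norm_num
  have a2 : e₂ 0 ^ 2 + e₂ 1 ^ 2 = 1 := by rw [← E2_normsq, he₂]; norm_num
  have a3 : (l₁ * e₁ 0 + l₂ * e₂ 0) ^ 2 + (l₁ * e₁ 1 + l₂ * e₂ 1) ^ 2 = 1 := by
    have := E2_normsq e
    rw [hnorm, he] at this
    simp at this
    linarith
  set a := e₁ 0 with ha
  set b := e₁ 1 with hb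
  set c := e₂ 0 with hc
  set f := e₂ 1 with hf
  have hD : a * f - b * c ≠ 0 := by
    intro h
    have key : (a * c + b * f) ^ 2 = 1 := by
      have : (a * c + b * f) ^ 2 + (a * f - b * c) ^ 2 = (a ^ 2 + b ^ 2) * (c ^ 2 + f ^ 2) := by ring
      rw [h, a1, a2] at this; linarith
    have : (a * c + b * f - 1) * (a * c + b * f + 1) = 0 := by linarith
    rcases mul_eq_zero.1 this with h1 | h1
    · apply hne
      have : (a - c) ^ 2 + (b - f) ^ 2 = 0 := by linarith
      apply E2_ext
      · nlinarith [sq_nonneg (a - c), sq_nonneg (b - f)]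
      · nlinarith [sq_nonneg (a - c), sq_nonneg (b - f)]
    · apply hne'
      have : (a + c) ^ 2 + (b + f) ^ 2 = 0 := by linarith
      apply E2_ext
      · simp only [PiLp.neg_apply]; nlinarith [sq_nonneg (a + c), sq_nonneg (b + f)]
      · simp only [PiLp.neg_apply]; nlinarith [sq_nonneg (a + c), sq_nonneg (b + f)]
  obtain ⟨σ, d, hσ, hd, hdD⟩ : ∃ σ d : ℝ, σ ^ 2 = 1 ∧ 0 < d ∧ d = σ * (a * f - b * c) := by
    rcases lt_or_gt_of_ne hD with h | h
    · exact ⟨-1, -(a * f - b * c), by norm_num, by linarith, by ring⟩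
    · exact ⟨1, (a * f - b * c), by norm_num, by linarith, by ring⟩
  have hdd : d * σ = a * f - b * c := by rw [hdD]; linear_combination (a * f - b * c) * hσ
  have hd0 : d ≠ 0 := hd.ne'
  refine ⟨!₂[σ * b, -σ * a], !₂[-σ * f, σ * c], d, ⟨hd, he₁, he₂, ?_, ?_, ?_, ?_, ?_, ?_, ?_, ?_, ?_⟩, ?_, ?_⟩
  · apply norm_one_of_sq; rw [E2_normsq]; simp; linear_combination σ ^ 2 * a1 + hσ
  · apply norm_one_of_sq; rw [E2_normsq]; simp; linear_combination σ ^ 2 * a2 + hσ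
  · rw [E2_inner]; simp [← ha, ← hb]; ring
  · rw [E2_inner]; simp [← hc, ← hf]; ring
  · rw [E2_inner]; simp [← hc, ← hf]; rw [hdD]; ring
  · rw [E2_inner]; simp [← ha, ← hb]; rw [hdD]; ring
  · intro v
    rw [E2_inner, E2_inner]
    apply E2_ext
    · simp [← ha, ← hb, ← hc, ← hf]
      field_simp
      rw [hdD]; ring
    · simp [← ha, ← hb, ← hc, ← hf]
      field_simp
      rw [hdD]; ring
  · intro v
    rw [E2_inner, E2_inner, E2_normsq]; simp [← ha, ← hb]
    linear_combination (-(v 0 ^ 2 + v 1 ^ 2)) * a1 - (v 0 * b - v 1 * a) ^ 2 * hσ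
  · intro v
    rw [E2_inner, E2_inner, E2_normsq]; simp [← hc, ← hf]
    linear_combination (-(v 0 ^ 2 + v 1 ^ 2)) * a2 - (v 0 * f - v 1 * c) ^ 2 * hσ
  · apply norm_one_of_sq; rw [E2_normsq]; simp
    linear_combination σ ^ 2 * a3 + hσ
  · rw [E2_inner]; rw [hdD]; simp only [← ha, ← hb, ← hc, ← hf]
    linear_combination (a * f - b * c) ^ 2 * hσ + (c ^ 2 + f ^ 2) * a1 + a2

lemma angle_part (e₁ e₂ e : E2) (l₁ l₂ d : ℝ) (he₁ : ‖e₁‖ = 1) (he₂ : ‖e₂‖ = 1)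
    (hl₁ : 0 < l₁) (hl₂ : 0 < l₂) (hd : 0 < d) (hd2 : d ^ 2 = 1 - ⟪e₁, e₂⟫ ^ 2)
    (he : e = l₁ • e₁ + l₂ • e₂) (hnorm : ‖e‖ = 1) :
    l₁ = Real.sin (InnerProductGeometry.angle e₂ e) /
      Real.sin (InnerProductGeometry.angle e₁ e + InnerProductGeometry.angle e₂ e) ∧
    l₂ = Real.sin (InnerProductGeometry.angle e₁ e) /
      Real.sin (InnerProductGeometry.angle e₁ e + InnerProductGeometry.angle e₂ e) := by
  set k := ⟪e₁, e₂⟫ with hk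
  have h11 : ⟪e₁, e₁⟫ = 1 := by rw [real_inner_self_eq_norm_sq, he₁]; norm_num
  have h22 : ⟪e₂, e₂⟫ = 1 := by rw [real_inner_self_eq_norm_sq, he₂]; norm_num
  have hee : ⟪e, e⟫ = 1 := by rw [real_inner_self_eq_norm_sq, hnorm]; norm_num
  have h1e : ⟪e₁, e⟫ = l₁ + l₂ * k := by
    rw [he, inner_add_right, inner_smul_right, inner_smul_right, h11]; ring
  have h2e : ⟪e₂, e⟫ = l₁ * k + l₂ := by
    rw [he, inner_add_right, inner_smul_right, inner_smul_right, h22, real_inner_comm]; ring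
  have hone : l₁ ^ 2 + 2 * l₁ * l₂ * k + l₂ ^ 2 = 1 := by
    have : ⟪e, e⟫ = l₁ * ⟪e₁, e⟫ + l₂ * ⟪e₂, e⟫ := by
      nth_rewrite 1 [he]
      rw [inner_add_left, real_inner_smul_left, real_inner_smul_left]
    rw [hee, h1e, h2e] at this; linarith
  have c1 : Real.cos (InnerProductGeometry.angle e₁ e) = l₁ + l₂ * k := by
    rw [InnerProductGeometry.cos_angle, he₁, hnorm, h1e]; simp
  have c2 : Real.cos (InnerProductGeometry.angle e₂ e) = l₁ * k + l₂ := by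
    rw [InnerProductGeometry.cos_angle, he₂, hnorm, h2e]; simp
  have s1 : Real.sin (InnerProductGeometry.angle e₁ e) = l₂ * d := by
    have := InnerProductGeometry.sin_angle_mul_norm_mul_norm e₁ e
    rw [he₁, hnorm, h11, hee, h1e] at this
    rw [show (1:ℝ) * 1 - (l₁ + l₂ * k) * (l₁ + l₂ * k) = (l₂ * d) ^ 2 by
      rw [mul_pow, hd2]; linear_combination -hone, Real.sqrt_sq (by positivity)] at this
    linarith
  have s2 : Real.sin (InnerProductGeometry.angle e₂ e) = l₁ * d := by
    have := InnerProductGeometry.sin_angle_mul_norm_mul_norm e₂ e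
    rw [he₂, hnorm, h22, hee, h2e] at this
    rw [show (1:ℝ) * 1 - (l₁ * k + l₂) * (l₁ * k + l₂) = (l₁ * d) ^ 2 by
      rw [mul_pow, hd2]; linear_combination -hone, Real.sqrt_sq (by positivity)] at this
    linarith
  have ss : Real.sin (InnerProductGeometry.angle e₁ e + InnerProductGeometry.angle e₂ e) = d := by
    rw [Real.sin_add, c1, c2, s1, s2]; linear_combination d * hone
  rw [ss, s1, s2]
  constructor <;> field_simp

structure Ctx (C : Set E2) (r₀ e₁ e₂ u₁ u₂ e : E2) (l₁ l₂ d : ℝ) : Prop where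
  fr : Fr e₁ e₂ u₁ u₂ d
  l1 : 0 < l₁
  l2 : 0 < l₂
  he : e = l₁ • e₁ + l₂ • e₂
  unit : ‖l₁ • u₁ - l₂ • u₂‖ = 1
  cpt : IsCompact C
  cvx : Convex ℝ C
  int : (interior C).Nonempty
  sub1 : ∀ r ∈ C, ⟪r - r₀, e₁⟫ ≤ 0
  sub2 : ∀ r ∈ C, ⟪r - r₀, e₂⟫ ≤ 0
  inn : ∀ q : E2, ⟪q, e₁⟫ < 0 → ⟪q, e₂⟫ < 0 → ∃ τ > (0 : ℝ), ∀ s : ℝ, 0 ≤ s → s ≤ τ → r₀ + s • q ∈ C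

lemma Ctx.symm {C : Set E2} {r₀ e₁ e₂ u₁ u₂ e : E2} {l₁ l₂ d : ℝ}
    (h : Ctx C r₀ e₁ e₂ u₁ u₂ e l₁ l₂ d) : Ctx C r₀ e₂ e₁ u₂ u₁ e l₂ l₁ d where
  fr := h.fr.symm
  l1 := h.l2
  l2 := h.l1
  he := by rw [h.he, add_comm]
  unit := by rw [norm_sub_rev]; exact h.unit
  cpt := h.cpt
  cvx := h.cvx
  int := h.int
  sub1 := h.sub2
  sub2 := h.sub1
  inn := fun q h1 h2 => h.inn q h2 h1

lemma mk_ctx {C : Set E2} {r₀ e₁ e₂ u₁ u₂ e : E2} {l₁ l₂ d : ℝ}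
    (hC : IsConvexBody2 C) (hr₀ : r₀ ∈ frontier C) (hcone : tanCone2 C r₀ = angleCone e₁ e₂)
    (fr : Fr e₁ e₂ u₁ u₂ d) (hl₁ : 0 < l₁) (hl₂ : 0 < l₂) (he : e = l₁ • e₁ + l₂ • e₂)
    (hu : ‖l₁ • u₁ - l₂ • u₂‖ = 1) : Ctx C r₀ e₁ e₂ u₁ u₂ e l₁ l₂ d := by
  obtain ⟨cpt, cvx, int⟩ := hC
  have hr : r₀ ∈ C := cpt.isClosed.frontier_subset hr₀
  have sub : ∀ r ∈ C, r - r₀ ∈ angleCone e₁ e₂ := by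
    intro r hr
    rw [← hcone]
    exact subset_closure ⟨1, r, hr, zero_le_one, by simp⟩
  refine ⟨fr, hl₁, hl₂, he, hu, cpt, cvx, int, fun r hr => (sub r hr).1, fun r hr => (sub r hr).2, ?_⟩
  intro q h1 h2
  set K : Set E2 := {v : E2 | ∃ c : ℝ, ∃ r ∈ C, 0 ≤ c ∧ v = c • (r - r₀)} with hK
  have Kc : Convex ℝ K := by
    rintro x ⟨c, r, hr, hc, rfl⟩ y ⟨c', r', hr', hc', rfl⟩ a b ha hb hab
    rcases eq_or_lt_of_le (show 0 ≤ a * c + b * c' by positivity) with h | h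
    · refine ⟨0, r, hr, le_rfl, ?_⟩
      have h1 : a * c = 0 := by nlinarith [mul_nonneg ha hc, mul_nonneg hb hc']
      have h2 : b * c' = 0 := by nlinarith [mul_nonneg ha hc, mul_nonneg hb hc']
      rw [smul_smul, smul_smul, h1, h2]; simp
    · refine ⟨a * c + b * c', (a * c / (a * c + b * c')) • r + (b * c' / (a * c + b * c')) • r',
        cvx hr hr' (by positivity) (by positivity) (by field_simp), h.le, ?_⟩
      set m := a * c + b * c' with hm
      have e1 : m * (a * c / m) = a * c := by field_simp
      have e2 : m * (b * c' / m) = b * c' := by field_simp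
      rw [smul_sub m, smul_add m, smul_smul m, smul_smul m, e1, e2, hm]
      module
  have Kint : (interior K).Nonempty := by
    obtain ⟨p, hp⟩ := int
    refine ⟨p - r₀, ?_⟩
    rw [mem_interior]
    refine ⟨(fun x => x + r₀) ⁻¹' interior C, ?_, isOpen_interior.preimage (by fun_prop), by simpa using hp⟩
    intro x hx
    exact ⟨1, x + r₀, interior_subset hx, zero_le_one, by simp⟩
  have hq : q ∈ interior (closure K) := by
    rw [show closure K = angleCone e₁ e₂ from hcone, mem_interior]
    refine ⟨{v | ⟪v, e₁⟫ < 0 ∧ ⟪v, e₂⟫ < 0}, fun v hv => ⟨hv.1.le, hv.2.le⟩, ?_, ⟨h1, h2⟩⟩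
    have o1 : IsOpen {v : E2 | ⟪v, e₁⟫ < 0} := isOpen_lt (by fun_prop) continuous_const
    have o2 : IsOpen {v : E2 | ⟪v, e₂⟫ < 0} := isOpen_lt (by fun_prop) continuous_const
    exact o1.inter o2
  rw [Kc.interior_closure_eq_interior_of_nonempty_interior Kint] at hq
  obtain ⟨c, r, hrC, hc, rfl⟩ := interior_subset hq
  refine ⟨1 / (c + 1), by positivity, fun s hs hs' => ?_⟩
  rw [smul_smul]
  have : s * c ≤ 1 := by
    rw [le_div_iff₀ (by positivity)] at hs'; nlinarith
  have := cvx hr hrC (show 0 ≤ 1 - s * c by linarith) (show 0 ≤ s * c by positivity) (by ring)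
  convert this using 1
  module

/-- Convexity: normals near `r₀` on the first side are close to `e₁`. -/
lemma Ctx.near {C : Set E2} {r₀ e₁ e₂ u₁ u₂ e : E2} {l₁ l₂ d : ℝ}
    (h : Ctx C r₀ e₁ e₂ u₁ u₂ e l₁ l₂ d) (ε : ℝ) (hε : 0 < ε) :
    ∃ ρ > (0 : ℝ), ∀ r ∈ C, ‖r - r₀‖ ≤ ρ → r ≠ r₀ → ⟪r - r₀, e₂⟫ ≤ ⟪r - r₀, e₁⟫ →
      ∀ n, IsOutwardNormalAt2 C r n → ‖n - e₁‖ ≤ ε := by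
  have hd := h.fr.dpos
  obtain ⟨δ, hδ, hδ1, hδ2, hδ3⟩ : ∃ δ : ℝ, 0 < δ ∧ δ ≤ 1 / 4 ∧ 3 * δ ≤ ε ∧ 8 * δ ≤ d := by
    refine ⟨min (1/4) (min (ε/3) (d/8)), by positivity, min_le_left _ _, ?_, ?_⟩
    · have := (min_le_right (1/4) (min (ε/3) (d/8))).trans (min_le_left _ _); linarith
    · have := (min_le_right (1/4) (min (ε/3) (d/8))).trans (min_le_right _ _); linarith
  have bound : ∀ {v w : E2}, ‖w‖ = 1 → (∃ τ > (0 : ℝ), ∀ s : ℝ, 0 ≤ s → s ≤ τ → r₀ + s • (v + δ • w) ∈ C) →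
      ∃ ρ > (0 : ℝ), ∀ r, ‖r - r₀‖ ≤ ρ → ∀ n, IsOutwardNormalAt2 C r n → ⟪v, n⟫ ≤ 2 * δ := by
    rintro v w hw ⟨τ, hτ, hs⟩
    refine ⟨δ * τ, by positivity, fun r hr n hn => ?_⟩
    have h1 := hn.2 _ (hs τ hτ.le le_rfl)
    have h2 : ⟪r - r₀, n⟫ ≤ δ * τ := (real_inner_le_norm _ _).trans (by rw [hn.1]; linarith)
    have h3 : -1 ≤ ⟪w, n⟫ := by
      have := neg_le_of_abs_le (abs_real_inner_le_norm w n)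
      rw [hw, hn.1] at this; linarith
    have e1 : r₀ + τ • (v + δ • w) - r = τ • (v + δ • w) - (r - r₀) := by abel
    rw [e1, inner_sub_left, real_inner_smul_left, inner_add_left, real_inner_smul_left] at h1
    have : τ * ⟪v, n⟫ ≤ τ * (2 * δ) := by nlinarith [mul_pos hτ hδ]
    exact le_of_mul_le_mul_left this hτ
  obtain ⟨ρ₁, hρ₁, H1⟩ := bound (v := u₁) (w := u₂) h.fr.u2 (h.inn _
    (by rw [inner_add_left, real_inner_smul_left, h.fr.u1e1, h.fr.u2e1]; nlinarith)
    (by rw [inner_add_left, real_inner_smul_left, h.fr.u1e2, h.fr.u2e2]; nlinarith))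
  obtain ⟨ρ₂, hρ₂, H2⟩ := bound (v := u₂) (w := u₁) h.fr.u1 (h.inn _
    (by rw [inner_add_left, real_inner_smul_left, h.fr.u1e1, h.fr.u2e1]; nlinarith)
    (by rw [inner_add_left, real_inner_smul_left, h.fr.u1e2, h.fr.u2e2]; nlinarith))
  refine ⟨min ρ₁ ρ₂, by positivity, fun r hr hρ hne hxy n hn => ?_⟩
  have b1 := H1 r (hρ.trans (min_le_left _ _)) n hn
  have b2 := H2 r (hρ.trans (min_le_right _ _)) n hn
  have x0 := h.sub1 r hr
  have y0 := h.sub2 r hr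
  have hr0 : r₀ ∈ C := by
    obtain ⟨τ, hτ, hs⟩ := h.inn (u₁ + u₂)
      (by rw [inner_add_left, h.fr.u1e1, h.fr.u2e1]; linarith)
      (by rw [inner_add_left, h.fr.u1e2, h.fr.u2e2]; linarith)
    simpa using hs 0 le_rfl hτ.le
  have hn0 : 0 ≤ ⟪r - r₀, n⟫ := by
    have := hn.2 _ hr0
    rw [← neg_sub, inner_neg_left] at this; linarith
  have hy : ⟪r - r₀, e₂⟫ < 0 := by
    rcases eq_or_lt_of_le y0 with h0 | h0
    · exfalso
      have h1 : ⟪r - r₀, e₁⟫ = 0 := by linarith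
      have := h.fr.dec (r - r₀)
      rw [h0, h1] at this
      simp [sub_eq_zero] at this
      exact hne this
    · exact h0
  have hA : -(2 * δ) ≤ ⟪u₁, n⟫ := by
    have h1 : ⟪r - r₀, n⟫ = (-(⟪r - r₀, e₂⟫ / d)) * ⟪u₁, n⟫ + (-(⟪r - r₀, e₁⟫ / d)) * ⟪u₂, n⟫ := by
      conv_lhs => rw [h.fr.dec (r - r₀)]
      rw [inner_add_left, real_inner_smul_left, real_inner_smul_left]
    rw [h1] at hn0
    set y := ⟪r - r₀, e₂⟫
    set x := ⟪r - r₀, e₁⟫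
    have h2 : 0 ≤ (-y) * ⟪u₁, n⟫ + (-x) * ⟪u₂, n⟫ := by
      have := mul_nonneg hd.le hn0
      have e : d * (-(y / d) * ⟪u₁, n⟫ + -(x / d) * ⟪u₂, n⟫) = (-y) * ⟪u₁, n⟫ + (-x) * ⟪u₂, n⟫ := by
        field_simp
      linarith
    have h3 : 0 ≤ (-y) * (⟪u₁, n⟫ + 2 * δ) := by nlinarith
    have := nonneg_of_mul_nonneg_right h3 (by linarith : 0 < -y)
    linarith
  have hp := h.fr.p1 n
  have hq := h.fr.dec e₁
  have hu2 : ⟪u₂, n⟫ = -d * ⟪n, e₁⟫ + ⟪u₁, u₂⟫ * ⟪u₁, n⟫ := by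
    have := h.fr.p1 (n + u₂)
    have t1 := h.fr.p1 u₂
    rw [norm_add_sq_real, inner_add_left, inner_add_left, hp, t1, h.fr.u2e1] at this
    rw [real_inner_comm u₂ n, real_inner_comm u₁ n] at *
    rw [real_inner_comm u₁ u₂] at *
    nlinarith
  have hc : |⟪u₁, u₂⟫| ≤ 1 := by
    have := abs_real_inner_le_norm u₁ u₂
    rw [h.fr.u1, h.fr.u2] at this; linarith
  have habs : |⟪u₁, n⟫| ≤ 2 * δ := abs_le.2 ⟨hA, b1⟩
  have hcu : |⟪u₁, u₂⟫ * ⟪u₁, n⟫| ≤ 2 * δ := by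
    rw [abs_mul]; nlinarith [abs_nonneg ⟪u₁, n⟫, abs_nonneg ⟪u₁, u₂⟫]
  have hpos : -(1/2) ≤ ⟪n, e₁⟫ := by
    have := (abs_le.1 hcu).1
    by_contra hcon
    push Not at hcon
    nlinarith
  rw [hn.1, real_inner_comm u₁ n] at hp
  have hsq : ⟪u₁, n⟫ ^ 2 ≤ 4 * δ ^ 2 := by
    rw [← sq_abs]; nlinarith [abs_nonneg ⟪u₁, n⟫]
  have hle1 : ⟪n, e₁⟫ ≤ 1 := by
    have := real_inner_le_norm n e₁
    rw [hn.1, h.fr.e1] at this; linarith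
  have hge : 0 ≤ ⟪n, e₁⟫ := by
    by_contra hcon
    push Not at hcon
    nlinarith
  have hn2 : ‖n - e₁‖ ^ 2 ≤ (3 * δ) ^ 2 := by
    rw [norm_sub_sq_real, hn.1, h.fr.e1]
    nlinarith
  have := abs_le_of_sq_le_sq hn2 (by positivity)
  rw [abs_of_nonneg (norm_nonneg _)] at this
  linarith

lemma exists_normal {C : Set E2} (cvx : Convex ℝ C) (int : (interior C).Nonempty) {r : E2}
    (hr : r ∈ frontier C) : ∃ n, IsOutwardNormalAt2 C r n := by
  obtain ⟨f, hf⟩ := geometric_hahn_banach_open_point cvx.interior isOpen_interior hr.2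
  set n := (InnerProductSpace.toDual ℝ E2).symm f with hn
  have hfn : ∀ x, f x = ⟪x, n⟫ := by
    intro x
    rw [real_inner_comm, hn, InnerProductSpace.toDual_symm_apply]
  have hle : ∀ x ∈ C, f x ≤ f r := by
    intro x hx
    have hx' : x ∈ closure (interior C) := by
      rw [cvx.closure_interior_eq_closure_of_nonempty_interior int]; exact subset_closure hx
    have hcl : IsClosed {x | f x ≤ f r} := isClosed_le f.continuous continuous_const
    exact closure_minimal (fun y hy => (hf y hy).le) hcl hx'
  have hn0 : n ≠ 0 := by
    intro h0
    obtain ⟨p, hp⟩ := int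
    have := hf p hp
    rw [hfn, hfn, h0] at this
    simp at this
  refine ⟨‖n‖⁻¹ • n, ?_, fun x hx => ?_⟩
  · rw [norm_smul, norm_inv, norm_norm, inv_mul_cancel₀ (norm_ne_zero_iff.2 hn0)]
  · have := hle x hx
    rw [hfn, hfn] at this
    rw [inner_smul_right, inner_sub_left]
    exact mul_nonpos_of_nonneg_of_nonpos (by positivity) (by linarith)

lemma normalMap2_spec {C : Set E2} {r : E2} (hr : IsRegularPt2 C r) :
    IsOutwardNormalAt2 C r (normalMap2 C r) := by
  have h : ∃ n : E2, IsOutwardNormalAt2 C r n := hr.exists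
  rw [normalMap2, dif_pos h]
  exact h.choose_spec

lemma countable_nonreg {C : Set E2} (cvx : Convex ℝ C) (int : (interior C).Nonempty) :
    {r | r ∈ frontier C ∧ ¬ IsRegularPt2 C r}.Countable := by
  let N : E2 → Set E2 := fun r => {n | ∀ x ∈ C, ⟪x - r, n⟫ ≤ 0}
  have Nint : ∀ r ∈ {r | r ∈ frontier C ∧ ¬ IsRegularPt2 C r}, (interior (N r)).Nonempty := by
    rintro r ⟨hr, hreg⟩
    obtain ⟨n, hn⟩ := exists_normal cvx int hr
    obtain ⟨m, hm, hmn⟩ : ∃ m, IsOutwardNormalAt2 C r m ∧ m ≠ n := by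
      by_contra hcon
      push Not at hcon
      exact hreg ⟨n, hn, hcon⟩
    have hmn' : m ≠ -n := by
      intro hneg
      obtain ⟨p, hp⟩ := int
      have hz : ∀ x ∈ C, ⟪x - r, n⟫ = 0 := by
        intro x hx
        have h1 := hn.2 x hx
        have h2 := hm.2 x hx
        rw [hneg, inner_neg_right] at h2
        linarith
      have hc : Continuous (fun s : ℝ => p + s • n) := by fun_prop
      have : ∀ᶠ s : ℝ in 𝓝[>] 0, p + s • n ∈ C := by
        have h0 : Tendsto (fun s : ℝ => p + s • n) (𝓝 0) (𝓝 p) := by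
          simpa using hc.tendsto 0
        exact (h0.mono_left nhdsWithin_le_nhds).eventually (mem_interior_iff_mem_nhds.1 hp)
      obtain ⟨s, hs, hs0⟩ := (this.and self_mem_nhdsWithin).exists
      have h1 := hz _ hs
      have h2 := hz p (interior_subset hp)
      rw [show p + s • n - r = (p - r) + s • n by abel, inner_add_left, h2, real_inner_smul_left,
        real_inner_self_eq_norm_sq, hn.1] at h1
      have : (0 : ℝ) < s := hs0
      linarith
    have hli : LinearIndependent ℝ ![m, n] := by
      rw [LinearIndependent.pair_iff]
      intro a b hab
      have h1 : ‖a • m‖ = ‖b • n‖ := by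
        rw [eq_neg_of_add_eq_zero_left hab, norm_neg]
      rw [norm_smul, norm_smul, hm.1, hn.1] at h1
      simp only [mul_one, Real.norm_eq_abs] at h1
      rcases abs_eq_abs.1 h1 with h | h
      · subst h
        by_cases ha : a = 0
        · exact ⟨ha, ha⟩
        · exfalso
          rw [← smul_add, smul_eq_zero] at hab
          exact hmn' (eq_neg_of_add_eq_zero_left (hab.resolve_left ha))
      · subst h
        by_cases hb : b = 0
        · simp [hb]
        · exfalso
          have : b • (n - m) = 0 := by rw [← hab]; module
          rw [smul_eq_zero] at this
          exact hmn (sub_eq_zero.1 (this.resolve_left hb)).symm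
    have Ncv : Convex ℝ (N r) := by
      intro x hx y hy a b ha hb _ z hz
      rw [inner_add_right, inner_smul_right, inner_smul_right]
      have := mul_nonpos_of_nonneg_of_nonpos ha (hx z hz)
      have := mul_nonpos_of_nonneg_of_nonpos hb (hy z hz)
      linarith
    rw [Ncv.interior_nonempty_iff_affineSpan_eq_top]
    have h0 : (0 : E2) ∈ N r := fun x _ => by simp
    have hspan : Submodule.span ℝ (Set.range ![m, n]) = ⊤ :=
      hli.span_eq_top_of_card_eq_finrank (by simp)
    have hsp2 : Submodule.span ℝ (N r) = ⊤ := by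
      rw [eq_top_iff, ← hspan]
      apply Submodule.span_mono
      rintro _ ⟨i, rfl⟩
      fin_cases i
      · exact hm.2
      · exact hn.2
    rw [AffineSubspace.affineSpan_eq_top_iff_vectorSpan_eq_top_of_nonempty _ _ _ ⟨0, h0⟩,
      vectorSpan_eq_span_vsub_set_right ℝ h0]
    simpa using hsp2
  refine Set.PairwiseDisjoint.countable_of_nonempty_interior (s := fun r => interior (N r)) ?_ ?_
  · intro r hr r' hr' hne
    rw [Function.onFun, Set.disjoint_left]
    intro n hn hn'
    apply hne
    have hrC : ∀ {r}, r ∈ frontier C → r ∈ closure C := fun h => h.1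
    have ext : ∀ {r : E2} {m}, m ∈ N r → ∀ x ∈ closure C, ⟪x - r, m⟫ ≤ 0 := by
      intro r m hm x hx
      have hcl : IsClosed {x : E2 | ⟪x - r, m⟫ ≤ 0} := isClosed_le (by fun_prop) continuous_const
      exact closure_minimal (fun y hy => hm y hy) hcl hx
    have hz : ∀ m ∈ interior (N r) ∩ interior (N r'), ⟪r' - r, m⟫ = 0 := by
      rintro m ⟨h1, h2⟩
      have a1 := ext (interior_subset h1) r' (hrC hr'.1)
      have a2 := ext (interior_subset h2) r (hrC hr.1)
      rw [← neg_sub, inner_neg_left] at a2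
      linarith
    have hopen : IsOpen (interior (N r) ∩ interior (N r')) := isOpen_interior.inter isOpen_interior
    have hc : Continuous (fun s : ℝ => n + s • (r' - r)) := by fun_prop
    have : ∀ᶠ s : ℝ in 𝓝[>] 0, n + s • (r' - r) ∈ interior (N r) ∩ interior (N r') := by
      have h0 : Tendsto (fun s : ℝ => n + s • (r' - r)) (𝓝 0) (𝓝 n) := by
        simpa using hc.tendsto 0
      exact (h0.mono_left nhdsWithin_le_nhds).eventually (hopen.mem_nhds ⟨hn, hn'⟩)
    obtain ⟨s, hs, hs0⟩ := (this.and self_mem_nhdsWithin).exists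
    have h1 := hz _ hs
    have h2 := hz n ⟨hn, hn'⟩
    rw [inner_add_right, h2, inner_smul_right, real_inner_self_eq_norm_sq] at h1
    have hs0' : (0 : ℝ) < s := hs0
    have : ‖r' - r‖ = 0 := by
      have : ‖r' - r‖ ^ 2 = 0 := by
        rcases mul_eq_zero.1 (by linarith : s * ‖r' - r‖ ^ 2 = 0) with h | h
        · linarith
        · exact h
      exact pow_eq_zero_iff (two_ne_zero) |>.1 this
    exact (sub_eq_zero.1 (norm_eq_zero.1 this)).symm
  · intro r hr
    rw [interior_interior]
    exact Nint r hr

lemma measurable_reg {C : Set E2} (cvx : Convex ℝ C) (int : (interior C).Nonempty) :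
    MeasurableSet (frontier C ∩ {r | IsRegularPt2 C r}) := by
  have : frontier C ∩ {r | IsRegularPt2 C r} =
      frontier C \ {r | r ∈ frontier C ∧ ¬ IsRegularPt2 C r} := by
    ext r; simp only [mem_inter_iff, mem_ofPred_eq, Set.mem_sdiff]; tauto
  rw [this]
  exact isClosed_frontier.measurableSet.diff (countable_nonreg cvx int).measurableSet

lemma continuousOn_normalMap (C : Set E2) :
    ContinuousOn (normalMap2 C) {r | IsRegularPt2 C r} := by
  intro r hr
  refine (isCompact_sphere (0 : E2) 1).tendsto_nhds_of_unique_mapClusterPt ?_ ?_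
  · filter_upwards [self_mem_nhdsWithin] with x hx
    simpa using (normalMap2_spec hx).1
  · intro y hy hcl
    rw [mapClusterPt_iff_ultrafilter] at hcl
    obtain ⟨U, hU, hlim⟩ := hcl
    have hid : Tendsto (fun x : E2 => x) U (𝓝 r) := hU.trans nhdsWithin_le_nhds
    have hmem : ∀ᶠ x in (U : Filter E2), IsRegularPt2 C x := hU self_mem_nhdsWithin
    refine hr.unique ⟨by simpa using hy, fun x hx => ?_⟩ (normalMap2_spec hr)
    have : Tendsto (fun z => ⟪x - z, normalMap2 C z⟫) U (𝓝 ⟪x - r, y⟫) :=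
      (tendsto_const_nhds.sub hid).inner hlim
    refine le_of_tendsto this ?_
    filter_upwards [hmem] with z hz
    exact (normalMap2_spec hz).2 x hx

def Aset (C : Set E2) (r₀ e e₁ e₂ : E2) (t : ℝ) : Set E2 :=
  (Sset2 C r₀ e t ∩ {r : E2 | IsRegularPt2 C r}) ∩ {r | ⟪r - r₀, e₂⟫ ≤ ⟪r - r₀, e₁⟫}

section
variable {C : Set E2} {r₀ e₁ e₂ u₁ u₂ e : E2} {l₁ l₂ d : ℝ}

lemma Ctx.inner_e (h : Ctx C r₀ e₁ e₂ u₁ u₂ e l₁ l₂ d) (v : E2) :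
    ⟪v, e⟫ = l₁ * ⟪v, e₁⟫ + l₂ * ⟪v, e₂⟫ := by
  rw [h.he, inner_add_right, inner_smul_right, inner_smul_right]

lemma Ctx.small2 (h : Ctx C r₀ e₁ e₂ u₁ u₂ e l₁ l₂ d) {r : E2} (hr : r ∈ C) {t : ℝ}
    (ht : ⟪r - r₀, e⟫ ≥ -t) : -(⟪r - r₀, e₂⟫ / d) ≤ t / (l₂ * d) := by
  have hd := h.fr.dpos
  have h1 := h.l1
  have h2 := h.l2
  have := h.sub1 r hr
  rw [h.inner_e] at ht
  have h3 : -⟪r - r₀, e₂⟫ * l₂ ≤ t := by nlinarith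
  rw [← neg_div, div_le_div_iff₀ hd (by positivity)]
  nlinarith

lemma Ctx.small (h : Ctx C r₀ e₁ e₂ u₁ u₂ e l₁ l₂ d) {r : E2} (hr : r ∈ C) {t : ℝ}
    (ht : ⟪r - r₀, e⟫ ≥ -t) : ‖r - r₀‖ ≤ (1 / (l₂ * d) + 1 / (l₁ * d)) * t := by
  have hd := h.fr.dpos
  have a := h.small2 hr ht
  have b := h.symm.small2 hr ht
  have a0 : 0 ≤ -(⟪r - r₀, e₂⟫ / d) := by
    rw [← neg_div]; exact div_nonneg (by linarith [h.sub2 r hr]) hd.le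
  have b0 : 0 ≤ -(⟪r - r₀, e₁⟫ / d) := by
    rw [← neg_div]; exact div_nonneg (by linarith [h.sub1 r hr]) hd.le
  calc ‖r - r₀‖ = ‖(-(⟪r - r₀, e₂⟫ / d)) • u₁ + (-(⟪r - r₀, e₁⟫ / d)) • u₂‖ := by
        rw [← h.fr.dec]
    _ ≤ -(⟪r - r₀, e₂⟫ / d) + -(⟪r - r₀, e₁⟫ / d) := by
        refine (norm_add_le _ _).trans ?_
        rw [norm_smul, norm_smul, h.fr.u1, h.fr.u2, Real.norm_of_nonneg a0, Real.norm_of_nonneg b0]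
        simp
    _ ≤ t / (l₂ * d) + t / (l₁ * d) := add_le_add a b
    _ = _ := by ring

lemma Ctx.mem0 (h : Ctx C r₀ e₁ e₂ u₁ u₂ e l₁ l₂ d) : r₀ ∈ C := by
  have hd := h.fr.dpos
  obtain ⟨τ, hτ, hs⟩ := h.inn (u₁ + u₂)
    (by rw [inner_add_left, h.fr.u1e1, h.fr.u2e1]; linarith)
    (by rw [inner_add_left, h.fr.u1e2, h.fr.u2e2]; linarith)
  simpa using hs 0 le_rfl hτ.le

lemma Fr.ne {e₁ e₂ u₁ u₂ : E2} {d : ℝ} (h : Fr e₁ e₂ u₁ u₂ d) : e₁ ≠ e₂ := by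
  intro he
  have h1 := h.u1e1
  have h2 := h.u1e2
  have := h.dpos
  rw [he] at h1
  linarith

lemma Ctx.ne_of_reg (h : Ctx C r₀ e₁ e₂ u₁ u₂ e l₁ l₂ d) {r : E2} (hr : IsRegularPt2 C r) :
    r ≠ r₀ := by
  rintro rfl
  exact h.fr.ne (hr.unique ⟨h.fr.e1, h.sub1⟩ ⟨h.fr.e2, h.sub2⟩)

lemma Ctx.nearA (h : Ctx C r₀ e₁ e₂ u₁ u₂ e l₁ l₂ d) (ε : ℝ) (hε : 0 < ε) :
    ∀ᶠ t : ℝ in 𝓝[>] 0, ∀ r ∈ Aset C r₀ e e₁ e₂ t, ‖normalMap2 C r - e₁‖ ≤ ε := by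
  obtain ⟨ρ, hρ, H⟩ := h.near ε hε
  have hd := h.fr.dpos
  have h1 := h.l1
  have h2 := h.l2
  have hlim : Tendsto (fun t : ℝ => (1 / (l₂ * d) + 1 / (l₁ * d)) * t) (𝓝[>] 0) (𝓝 0) := by
    have : Continuous (fun t : ℝ => (1 / (l₂ * d) + 1 / (l₁ * d)) * t) := by fun_prop
    simpa using (this.tendsto 0).mono_left nhdsWithin_le_nhds
  filter_upwards [hlim.eventually (eventually_le_nhds hρ)] with t ht r hr
  obtain ⟨⟨⟨hf, hS⟩, hreg⟩, hxy⟩ := hr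
  have hrC := h.cpt.isClosed.frontier_subset hf
  exact H r hrC ((h.small hrC hS).trans ht) (h.ne_of_reg hreg) hxy _ (normalMap2_spec hreg)

lemma Ctx.upper (h : Ctx C r₀ e₁ e₂ u₁ u₂ e l₁ l₂ d) (ε : ℝ) (hε : 0 < ε) (hε1 : ε < 1) :
    ∀ᶠ t : ℝ in 𝓝[>] 0, μH[1] (Aset C r₀ e e₁ e₂ t) ≤ ENNReal.ofReal
      (t * ((1 - ε)⁻¹ * (1 / (l₂ * d) + 2 * (1 / (l₂ * d) + 1 / (l₁ * d)) * ε / d))) := by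
  have hd := h.fr.dpos
  have h1 := h.l1
  have h2 := h.l2
  set K := 1 / (l₂ * d) + 1 / (l₁ * d) with hK
  have hKpos : 0 < K := by positivity
  filter_upwards [h.nearA ε hε, self_mem_nhdsWithin] with t hn ht
  have ht : 0 < t := ht
  set A := Aset C r₀ e e₁ e₂ t with hA
  let g : E2 → ℝ := fun r => ⟪r - r₀, u₁⟫
  -- inequality on the normal direction
  have key : ∀ p ∈ A, ∀ q ∈ C, ⟪q - p, e₁⟫ ≤ ε * ‖q - p‖ := by
    intro p hp q hq
    have a1 := (normalMap2_spec hp.1.2).2 q hq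
    have a2 : ⟪q - p, e₁ - normalMap2 C p⟫ ≤ ε * ‖q - p‖ := by
      refine (real_inner_le_norm _ _).trans ?_
      rw [norm_sub_rev e₁, mul_comm]
      exact mul_le_mul_of_nonneg_right (hn p hp) (norm_nonneg _)
    rw [inner_sub_right] at a2
    linarith
  have hAC : ∀ p ∈ A, p ∈ C := fun p hp => h.cpt.isClosed.frontier_subset hp.1.1.1
  have anti : ∀ p ∈ A, ∀ q ∈ A, ‖p - q‖ ≤ (1 - ε)⁻¹ * |g p - g q| := by
    intro p hp q hq
    have a1 := key p hp q (hAC q hq)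
    have a2 := key q hq p (hAC p hp)
    rw [← neg_sub, inner_neg_left, norm_neg] at a1
    have a3 := h.fr.p1 (p - q)
    have a4 : g p - g q = ⟪p - q, u₁⟫ := by
      simp only [g]; rw [← inner_sub_left]; congr 1; abel
    rw [a4]
    have a5 : ⟪p - q, e₁⟫ ^ 2 ≤ (ε * ‖p - q‖) ^ 2 := sq_le_sq' (by linarith) a2
    have a6 : ((1 - ε) * ‖p - q‖) ^ 2 ≤ ⟪p - q, u₁⟫ ^ 2 := by
      nlinarith [mul_nonneg (mul_nonneg hε.le (by linarith : (0:ℝ) ≤ 1 - ε)) (sq_nonneg ‖p - q‖)]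
    have a7 := sq_le_sq.1 a6
    rw [abs_of_nonneg (mul_nonneg (by linarith) (norm_nonneg _))] at a7
    rw [inv_mul_eq_div, le_div_iff₀ (by linarith)]
    linarith
  have inj : InjOn g A := by
    intro p hp q hq hpq
    have := anti p hp q hq
    rw [hpq] at this
    simp at this
    exact sub_eq_zero.1 this
  have himg : Function.invFunOn g A '' (g '' A) = A := inj.leftInvOn_invFunOn.image_image
  have hlip : LipschitzOnWith (Real.toNNReal (1 - ε)⁻¹) (Function.invFunOn g A) (g '' A) := by
    apply LipschitzOnWith.of_dist_le_mul
    rintro _ ⟨p, hp, rfl⟩ _ ⟨q, hq, rfl⟩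
    rw [inj.leftInvOn_invFunOn hp, inj.leftInvOn_invFunOn hq, dist_eq_norm, Real.dist_eq,
      Real.coe_toNNReal _ (inv_nonneg.2 (by linarith))]
    exact anti p hp q hq
  have hsub : g '' A ⊆ Icc (-(K * ε * t / d)) (t / (l₂ * d) + K * ε * t / d) := by
    rintro _ ⟨p, hp, rfl⟩
    have hpC := hAC p hp
    have b1 := h.small hpC hp.1.1.2
    have b2 := h.small2 hpC hp.1.1.2
    have b3 := key p hp r₀ h.mem0
    rw [← neg_sub, inner_neg_left, norm_neg] at b3
    have b4 := h.sub1 p hpC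
    have b5 := h.sub2 p hpC
    have b6 : g p = -(⟪p - r₀, e₂⟫ / d) + (-(⟪p - r₀, e₁⟫ / d)) * ⟪u₂, u₁⟫ := by
      simp only [g]
      conv_lhs => rw [h.fr.dec (p - r₀)]
      rw [inner_add_left, real_inner_smul_left, real_inner_smul_left, real_inner_self_eq_norm_sq,
        h.fr.u1]
      ring
    have b7 : |⟪u₂, u₁⟫| ≤ 1 := by
      have := abs_real_inner_le_norm u₂ u₁
      rw [h.fr.u1, h.fr.u2] at this; linarith
    have b8 : 0 ≤ -(⟪p - r₀, e₁⟫ / d) := by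
      rw [← neg_div]; exact div_nonneg (by linarith) hd.le
    have b8' : 0 ≤ -(⟪p - r₀, e₂⟫ / d) := by
      rw [← neg_div]; exact div_nonneg (by linarith) hd.le
    have b9 : -(⟪p - r₀, e₁⟫ / d) ≤ K * ε * t / d := by
      rw [← neg_div]
      apply div_le_div_of_nonneg_right _ hd.le
      nlinarith
    have b10 : |(-(⟪p - r₀, e₁⟫ / d)) * ⟪u₂, u₁⟫| ≤ K * ε * t / d := by
      rw [abs_mul, abs_of_nonneg b8]
      nlinarith [abs_nonneg ⟪u₂, u₁⟫]
    have := abs_le.1 b10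
    rw [b6]
    constructor <;> linarith
  calc μH[1] A = μH[1] (Function.invFunOn g A '' (g '' A)) := by rw [himg]
    _ ≤ (Real.toNNReal (1 - ε)⁻¹ : ℝ≥0∞) ^ (1 : ℝ) * μH[1] (g '' A) :=
        hlip.hausdorffMeasure_image_le zero_le_one
    _ ≤ ENNReal.ofReal (1 - ε)⁻¹ * volume (Icc (-(K * ε * t / d)) (t / (l₂ * d) + K * ε * t / d)) := by
        rw [ENNReal.rpow_one, hausdorffMeasure_real]
        exact mul_le_mul_right (measure_mono hsub) _
    _ = _ := by
        rw [Real.volume_Icc, ← ENNReal.ofReal_mul (inv_nonneg.2 (by linarith))]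
        congr 1
        field_simp
        ring

lemma Ctx.lower (h : Ctx C r₀ e₁ e₂ u₁ u₂ e l₁ l₂ d) (η : ℝ) (hη : 0 < η) (hη1 : η < d / 2) :
    ∀ᶠ t : ℝ in 𝓝[>] 0, ENNReal.ofReal (t * (1 / (l₂ * d + η * (l₁ + l₂)))) ≤
      μH[1] (Aset C r₀ e e₁ e₂ t) := by
  have hd := h.fr.dpos
  have h1 := h.l1
  have h2 := h.l2
  have h11 : ⟪e₁, e₁⟫ = 1 := by rw [real_inner_self_eq_norm_sq, h.fr.e1]; norm_num
  have huu : ⟪u₁, u₁⟫ = 1 := by rw [real_inner_self_eq_norm_sq, h.fr.u1]; norm_num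
  have hk : |⟪e₁, e₂⟫| ≤ 1 := by
    have := abs_real_inner_le_norm e₁ e₂
    rw [h.fr.e1, h.fr.e2] at this; linarith
  obtain ⟨hk1, hk2⟩ := abs_le.1 hk
  obtain ⟨τ, hτ, hin⟩ := h.inn (u₁ - η • e₁)
    (by rw [inner_sub_left, real_inner_smul_left, h.fr.u1e1, h11]; linarith)
    (by rw [inner_sub_left, real_inner_smul_left, h.fr.u1e2]; nlinarith)
  set M := l₂ * d + η * (l₁ + l₂) with hM
  have hMpos : 0 < M := by positivity
  have hlim : Tendsto (fun t : ℝ => t * (1 / M)) (𝓝[>] 0) (𝓝 0) := by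
    have : Continuous (fun t : ℝ => t * (1 / M)) := by fun_prop
    simpa using (this.tendsto 0).mono_left nhdsWithin_le_nhds
  filter_upwards [hlim.eventually (eventually_le_nhds hτ), self_mem_nhdsWithin] with t ht ht0
  have ht0 : 0 < t := ht0
  set F : Set E2 := Sset2 C r₀ e t ∩ {r | ⟪r - r₀, e₂⟫ ≤ ⟪r - r₀, e₁⟫} with hF
  let g : E2 → ℝ := fun r => ⟪r - r₀, u₁⟫
  have hsub : Ioc 0 (t * (1 / M)) ⊆ g '' F := by
    rintro s ⟨hs0, hs⟩
    let c : ℝ → E2 := fun y => r₀ + s • u₁ + y • e₁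
    have hc : Continuous c := by fun_prop
    have ce1 : ∀ y, ⟪c y - r₀, e₁⟫ = y := by
      intro y
      simp only [c]
      rw [show r₀ + s • u₁ + y • e₁ - r₀ = s • u₁ + y • e₁ by abel, inner_add_left,
        real_inner_smul_left, real_inner_smul_left, h.fr.u1e1, h11]; ring
    have ce2 : ∀ y, ⟪c y - r₀, e₂⟫ = -d * s + y * ⟪e₁, e₂⟫ := by
      intro y
      simp only [c]
      rw [show r₀ + s • u₁ + y • e₁ - r₀ = s • u₁ + y • e₁ by abel, inner_add_left,
        real_inner_smul_left, real_inner_smul_left, h.fr.u1e2]; ring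
    have cu1 : ∀ y, g (c y) = s := by
      intro y
      simp only [c, g]
      rw [show r₀ + s • u₁ + y • e₁ - r₀ = s • u₁ + y • e₁ by abel, inner_add_left,
        real_inner_smul_left, real_inner_smul_left, huu, real_inner_comm, h.fr.u1e1]; ring
    have hcp : IsCompact (Icc (-(η * s)) 1 ∩ c ⁻¹' C) :=
      isCompact_Icc.inter_right (h.cpt.isClosed.preimage hc)
    have hmem : -(η * s) ∈ Icc (-(η * s)) 1 ∩ c ⁻¹' C := by
      refine ⟨⟨le_rfl, by nlinarith⟩, ?_⟩
      have := hin s hs0.le (hs.trans ht)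
      rw [mem_preimage]
      convert this using 1
      simp only [c]
      module
    obtain ⟨y, hy, hmax⟩ := hcp.exists_isMaxOn ⟨_, hmem⟩ continuousOn_id
    have hyC : c y ∈ C := hy.2
    have hy0 : y ≤ 0 := by rw [← ce1 y]; exact h.sub1 _ hyC
    have hy1 : -(η * s) ≤ y := hy.1.1
    have hfr : c y ∈ frontier C := by
      refine ⟨subset_closure hyC, fun hyint => ?_⟩
      have : ∀ᶠ z in 𝓝[>] y, c z ∈ C :=
        ((hc.tendsto y).mono_left nhdsWithin_le_nhds).eventually (mem_interior_iff_mem_nhds.1 hyint)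
      obtain ⟨z, hz, hzy⟩ := (this.and self_mem_nhdsWithin).exists
      have hzy : y < z := hzy
      have hz0 : z ≤ 0 := by rw [← ce1 z]; exact h.sub1 _ hz
      have := hmax (show z ∈ Icc (-(η * s)) 1 ∩ c ⁻¹' C from ⟨⟨by linarith, by linarith⟩, hz⟩)
      simp at this
      linarith
    have hyk : |y * ⟪e₁, e₂⟫| ≤ η * s := by
      rw [abs_mul, abs_of_nonpos hy0]
      nlinarith [abs_nonneg ⟪e₁, e₂⟫]
    obtain ⟨hyk1, hyk2⟩ := abs_le.1 hyk
    refine ⟨c y, ⟨⟨hfr, ?_⟩, ?_⟩, cu1 y⟩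
    · rw [mem_ofPred_eq, h.inner_e, ce1, ce2]
      have hsM : s * M ≤ t := by
        have := mul_le_mul_of_nonneg_right hs hMpos.le
        rwa [mul_assoc, one_div, inv_mul_cancel₀ hMpos.ne', mul_one] at this
      nlinarith
    · rw [mem_ofPred_eq, ce1, ce2]
      nlinarith
  have hlip : LipschitzWith 1 g := by
    apply LipschitzWith.of_dist_le_mul
    intro p q
    rw [Real.dist_eq, dist_eq_norm]
    have : g p - g q = ⟪p - q, u₁⟫ := by
      simp only [g]; rw [← inner_sub_left]; congr 1; abel
    rw [this]
    have := abs_real_inner_le_norm (p - q) u₁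
    rw [h.fr.u1] at this
    simpa using this
  have hFA : F ⊆ Aset C r₀ e e₁ e₂ t ∪ {r | r ∈ frontier C ∧ ¬ IsRegularPt2 C r} := by
    rintro r ⟨hS, hxy⟩
    by_cases hreg : IsRegularPt2 C r
    · exact Or.inl ⟨⟨hS, hreg⟩, hxy⟩
    · exact Or.inr ⟨hS.1, hreg⟩
  have hnull : μH[1] {r : E2 | r ∈ frontier C ∧ ¬ IsRegularPt2 C r} = 0 := by
    have : NullSingletonClass (μH[1] : Measure E2) := Measure.nullSingletonClass_hausdorff E2 one_pos
    exact (countable_nonreg h.cvx h.int).measure_zero _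
  calc ENNReal.ofReal (t * (1 / M)) = volume (Ioc 0 (t * (1 / M))) := by simp
    _ ≤ volume (g '' F) := measure_mono hsub
    _ = μH[1] (g '' F) := by rw [hausdorffMeasure_real]
    _ ≤ μH[1] F := by simpa using hlip.hausdorffMeasure_image_le zero_le_one F
    _ ≤ μH[1] (Aset C r₀ e e₁ e₂ t) + 0 := by
        rw [← hnull]; exact (measure_mono hFA).trans (measure_union_le _ _)
    _ = _ := add_zero _

lemma tendsto_of_bounds {m F G : ℝ → ℝ} {ℓ : ℝ} (hF : Tendsto F (𝓝[>] 0) (𝓝 ℓ))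
    (hG : Tendsto G (𝓝[>] 0) (𝓝 ℓ))
    (hl : ∀ᶠ ε in 𝓝[>] (0 : ℝ), ∀ᶠ t in 𝓝[>] (0 : ℝ), F ε ≤ m t)
    (hu : ∀ᶠ ε in 𝓝[>] (0 : ℝ), ∀ᶠ t in 𝓝[>] (0 : ℝ), m t ≤ G ε) :
    Tendsto m (𝓝[>] 0) (𝓝 ℓ) := by
  rw [tendsto_order]
  constructor
  · intro a ha
    obtain ⟨ε, h1, h2⟩ := ((hF.eventually (lt_mem_nhds ha)).and hl).exists
    filter_upwards [h2] with t ht using h1.trans_le ht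
  · intro a ha
    obtain ⟨ε, h1, h2⟩ := ((hG.eventually (gt_mem_nhds ha)).and hu).exists
    filter_upwards [h2] with t ht using ht.trans_lt h1

lemma Ctx.finite (h : Ctx C r₀ e₁ e₂ u₁ u₂ e l₁ l₂ d) :
    ∀ᶠ t : ℝ in 𝓝[>] 0, μH[1] (Aset C r₀ e e₁ e₂ t) < ∞ := by
  filter_upwards [h.upper (1/2) (by norm_num) (by norm_num)] with t ht
  exact ht.trans_lt ENNReal.ofReal_lt_top

lemma eventually_small {a : ℝ} (ha : 0 < a) : ∀ᶠ ε : ℝ in 𝓝[>] 0, ε < a :=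
  nhdsWithin_le_nhds (gt_mem_nhds ha)

lemma Ctx.lim (h : Ctx C r₀ e₁ e₂ u₁ u₂ e l₁ l₂ d) :
    Tendsto (fun t => (μH[1] (Aset C r₀ e e₁ e₂ t)).toReal / t) (𝓝[>] 0) (𝓝 (1 / (l₂ * d))) := by
  have hd := h.fr.dpos
  have h1 := h.l1
  have h2 := h.l2
  refine tendsto_of_bounds (F := fun η => 1 / (l₂ * d + η * (l₁ + l₂)))
    (G := fun ε => (1 - ε)⁻¹ * (1 / (l₂ * d) + 2 * (1 / (l₂ * d) + 1 / (l₁ * d)) * ε / d)) ?_ ?_ ?_ ?_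
  · have : ContinuousAt (fun η : ℝ => 1 / (l₂ * d + η * (l₁ + l₂))) 0 := by
      refine ContinuousAt.div (by fun_prop) (by fun_prop) ?_
      simp; constructor <;> positivity
    simpa [ContinuousAt] using this.tendsto.mono_left nhdsWithin_le_nhds
  · have : ContinuousAt (fun ε => (1 - ε)⁻¹ * (1 / (l₂ * d) + 2 * (1 / (l₂ * d) + 1 / (l₁ * d)) * ε / d)) 0 := by
      refine ContinuousAt.mul (ContinuousAt.inv₀ (by fun_prop) (by norm_num)) (by fun_prop)
    simpa [ContinuousAt] using this.tendsto.mono_left nhdsWithin_le_nhds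
  · filter_upwards [self_mem_nhdsWithin, eventually_small (half_pos hd)] with η h0 hη
    filter_upwards [h.lower η h0 hη, h.finite, self_mem_nhdsWithin] with t ht hfin ht0
    have ht0 : 0 < t := ht0
    rw [le_div_iff₀ ht0]
    have := (ENNReal.ofReal_le_iff_le_toReal hfin.ne).1 ht
    linarith
  · filter_upwards [self_mem_nhdsWithin, eventually_small one_pos] with ε h0 hε
    filter_upwards [h.upper ε h0 hε, self_mem_nhdsWithin] with t ht ht0
    have ht0 : 0 < t := ht0
    have h0 : 0 < ε := h0
    rw [div_le_iff₀ ht0]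
    have h3 : 0 < 1 - ε := by linarith
    have := ENNReal.toReal_le_of_le_ofReal (by positivity) ht
    linarith

end

section
variable {C : Set E2} {r₀ e₁ e₂ u₁ u₂ e : E2} {l₁ l₂ d : ℝ}

lemma Ctx.B_bounds (h : Ctx C r₀ e₁ e₂ u₁ u₂ e l₁ l₂ d) :
    (∀ t > 0, μH[1] (Bset2 C r₀ e t) ≤ ENNReal.ofReal (t * (1 / (l₁ * l₂ * d)))) ∧
    (∀ δ, 0 < δ → δ < 1 / 2 → ∀ᶠ t : ℝ in 𝓝[>] 0,
      ENNReal.ofReal (t * ((1 - 2 * δ) * (1 / (l₁ * l₂ * d)))) ≤ μH[1] (Bset2 C r₀ e t)) := by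
  have hd := h.fr.dpos
  have h1 := h.l1
  have h2 := h.l2
  set P₁ : E2 := (1 / (l₂ * d)) • u₁ with hP1
  set P₂ : E2 := (1 / (l₁ * d)) • u₂ with hP2
  have hPP : P₁ - P₂ = (1 / (l₁ * l₂ * d)) • (l₁ • u₁ - l₂ • u₂) := by
    rw [smul_sub, smul_smul, smul_smul, hP1, hP2]
    congr 2 <;> field_simp
  have hL : ‖P₁ - P₂‖ = 1 / (l₁ * l₂ * d) := by
    rw [hPP, norm_smul, h.unit, Real.norm_of_nonneg (by positivity), mul_one]
  have P1e1 : ⟪P₁, e₁⟫ = 0 := by rw [hP1, real_inner_smul_left, h.fr.u1e1, mul_zero]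
  have P2e2 : ⟪P₂, e₂⟫ = 0 := by rw [hP2, real_inner_smul_left, h.fr.u2e2, mul_zero]
  have P1e2 : ⟪P₁, e₂⟫ = -(1 / l₂) := by
    rw [hP1, real_inner_smul_left, h.fr.u1e2]; field_simp
  have P2e1 : ⟪P₂, e₁⟫ = -(1 / l₁) := by
    rw [hP2, real_inner_smul_left, h.fr.u2e1]; field_simp
  constructor
  · intro t ht
    have hsub : Bset2 C r₀ e t ⊆ segment ℝ (r₀ + t • P₁) (r₀ + t • P₂) := by
      rintro r ⟨hrC, hr⟩
      rw [mem_ofPred_eq, h.inner_e] at hr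
      have x0 := h.sub1 r hrC
      have y0 := h.sub2 r hrC
      set x := ⟪r - r₀, e₁⟫ with hx
      set y := ⟪r - r₀, e₂⟫ with hy
      have hsum : -(l₂ * y) / t + -(l₁ * x) / t = 1 := by
        rw [← add_div, div_eq_one_iff_eq ht.ne']; linarith
      refine ⟨-(l₂ * y) / t, -(l₁ * x) / t, div_nonneg (by nlinarith) ht.le,
        div_nonneg (by nlinarith) ht.le, hsum, ?_⟩
      have e1 : (-(l₂ * y) / t) • (r₀ + t • P₁) + (-(l₁ * x) / t) • (r₀ + t • P₂) =
          (-(l₂ * y) / t + -(l₁ * x) / t) • r₀ + ((-(l₂ * y) / t * (t * (1 / (l₂ * d)))) • u₁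
            + (-(l₁ * x) / t * (t * (1 / (l₁ * d)))) • u₂) := by
        rw [hP1, hP2]; module
      rw [e1, hsum, one_smul]
      have e2 : -(l₂ * y) / t * (t * (1 / (l₂ * d))) = -(y / d) := by field_simp
      have e3 : -(l₁ * x) / t * (t * (1 / (l₁ * d))) = -(x / d) := by field_simp
      rw [e2, e3, hx, hy, ← h.fr.dec (r - r₀)]
      abel
    refine (measure_mono hsub).trans ?_
    rw [hausdorffMeasure_segment, edist_dist, dist_eq_norm,
      show r₀ + t • P₁ - (r₀ + t • P₂) = t • (P₁ - P₂) by module, norm_smul, hL,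
      Real.norm_of_nonneg ht.le]
  · intro δ hδ hδ1
    clear_value P₁ P₂
    have Q : ∀ a b : ℝ, 0 < a → 0 < b → a + b = 1 → ∃ τ > (0 : ℝ), ∀ s : ℝ, 0 < s → s ≤ τ →
        r₀ + s • (a • P₁ + b • P₂) ∈ Bset2 C r₀ e s := by
      intro a b ha hb hab
      have q1 : ⟪a • P₁ + b • P₂, e₁⟫ = -(b / l₁) := by
        rw [inner_add_left, real_inner_smul_left, real_inner_smul_left, P1e1, P2e1]; ring
      have q2 : ⟪a • P₁ + b • P₂, e₂⟫ = -(a / l₂) := by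
        rw [inner_add_left, real_inner_smul_left, real_inner_smul_left, P1e2, P2e2]; ring
      obtain ⟨τ, hτ, hs⟩ := h.inn (a • P₁ + b • P₂)
        (by rw [q1]; exact neg_neg_of_pos (by positivity))
        (by rw [q2]; exact neg_neg_of_pos (by positivity))
      refine ⟨τ, hτ, fun s hs0 hs1 => ⟨hs s hs0.le hs1, ?_⟩⟩
      rw [mem_ofPred_eq, add_sub_cancel_left, real_inner_smul_left, h.inner_e, q1, q2]
      field_simp
      linarith
    obtain ⟨τ₁, hτ₁, H1⟩ := Q (1 - δ) δ (by linarith) hδ (by ring)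
    obtain ⟨τ₂, hτ₂, H2⟩ := Q δ (1 - δ) hδ (by linarith) (by ring)
    filter_upwards [self_mem_nhdsWithin, eventually_small hτ₁, eventually_small hτ₂] with t ht0 ht1 ht2
    have ht0 : 0 < t := ht0
    have b1 := H1 t ht0 ht1.le
    have b2 := H2 t ht0 ht2.le
    have hBc : Convex ℝ (Bset2 C r₀ e t) := by
      refine h.cvx.inter ?_
      intro x hx y hy a b _ _ hab
      have hx : ⟪x - r₀, e⟫ = -t := hx
      have hy : ⟪y - r₀, e⟫ = -t := hy
      show ⟪a • x + b • y - r₀, e⟫ = -t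
      have : a • x + b • y - r₀ = a • (x - r₀) + b • (y - r₀) := by
        obtain rfl : b = 1 - a := by linarith
        module
      rw [this, inner_add_left, real_inner_smul_left, real_inner_smul_left, hx, hy]
      linear_combination -t * hab
    refine le_trans ?_ (measure_mono (hBc.segment_subset b1 b2))
    rw [hausdorffMeasure_segment, edist_dist, dist_eq_norm,
      show r₀ + t • ((1 - δ) • P₁ + δ • P₂) - (r₀ + t • (δ • P₁ + (1 - δ) • P₂)) =
        (t * (1 - 2 * δ)) • (P₁ - P₂) by module, norm_smul, hL,
      Real.norm_of_nonneg (mul_nonneg ht0.le (by linarith)), mul_assoc t]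

lemma Ctx.limB (h : Ctx C r₀ e₁ e₂ u₁ u₂ e l₁ l₂ d) :
    Tendsto (fun t => (μH[1] (Bset2 C r₀ e t)).toReal / t) (𝓝[>] 0) (𝓝 (1 / (l₁ * l₂ * d))) := by
  have hd := h.fr.dpos
  have h1 := h.l1
  have h2 := h.l2
  obtain ⟨hu, hl⟩ := h.B_bounds
  refine tendsto_of_bounds (F := fun δ => (1 - 2 * δ) * (1 / (l₁ * l₂ * d)))
    (G := fun _ => 1 / (l₁ * l₂ * d)) ?_ tendsto_const_nhds ?_ ?_
  · have : Continuous (fun δ => (1 - 2 * δ) * (1 / (l₁ * l₂ * d))) := by fun_prop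
    simpa using (this.tendsto 0).mono_left nhdsWithin_le_nhds
  · filter_upwards [self_mem_nhdsWithin, eventually_small (half_pos one_pos)] with δ h0 hδ
    filter_upwards [hl δ h0 hδ, self_mem_nhdsWithin] with t ht ht0
    have ht0 : 0 < t := ht0
    rw [le_div_iff₀ ht0]
    have := (ENNReal.ofReal_le_iff_le_toReal ((hu t ht0).trans_lt ENNReal.ofReal_lt_top).ne).1 ht
    linarith
  · refine Eventually.of_forall fun ε => ?_
    filter_upwards [self_mem_nhdsWithin] with t ht0
    have ht0 : 0 < t := ht0
    rw [div_le_iff₀ ht0]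
    have := ENNReal.toReal_le_of_le_ofReal (by positivity) (hu t ht0)
    linarith

lemma Ctx.measS (h : Ctx C r₀ e₁ e₂ u₁ u₂ e l₁ l₂ d) (t : ℝ) :
    MeasurableSet (Sset2 C r₀ e t ∩ {r : E2 | IsRegularPt2 C r}) := by
  have hm : IsClosed {r : E2 | ⟪r - r₀, e⟫ ≥ -t} := isClosed_le continuous_const (by fun_prop)
  have := (measurable_reg h.cvx h.int).inter hm.measurableSet
  rwa [inter_right_comm] at this

lemma Ctx.measA (h : Ctx C r₀ e₁ e₂ u₁ u₂ e l₁ l₂ d) (t : ℝ) :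
    MeasurableSet (Aset C r₀ e e₁ e₂ t) := by
  have hm : IsClosed {r : E2 | ⟪r - r₀, e₂⟫ ≤ ⟪r - r₀, e₁⟫} := isClosed_le (by fun_prop) (by fun_prop)
  exact (h.measS t).inter hm.measurableSet

lemma Ctx.integ (h : Ctx C r₀ e₁ e₂ u₁ u₂ e l₁ l₂ d) (f : BoundedContinuousFunction E2 ℝ) {t : ℝ}
    (hfin : μH[1] (Aset C r₀ e e₁ e₂ t) < ∞) :
    IntegrableOn (fun r => f (normalMap2 C r)) (Aset C r₀ e e₁ e₂ t) μH[1] := by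
  have hc : ContinuousOn (fun r => f (normalMap2 C r)) (Aset C r₀ e e₁ e₂ t) :=
    f.continuous.comp_continuousOn ((continuousOn_normalMap C).mono fun r hr => hr.1.2)
  refine IntegrableOn.of_bound hfin (hc.aestronglyMeasurable (h.measA t)) ‖f‖ ?_
  exact Eventually.of_forall fun r => f.norm_coe_le_norm _

lemma Ctx.limI (h : Ctx C r₀ e₁ e₂ u₁ u₂ e l₁ l₂ d) (f : BoundedContinuousFunction E2 ℝ) :
    Tendsto (fun t => (∫ r in Aset C r₀ e e₁ e₂ t, f (normalMap2 C r) ∂μH[1]) / t) (𝓝[>] 0)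
      (𝓝 (f e₁ * (1 / (l₂ * d)))) := by
  have hm := h.lim
  set ℓ := 1 / (l₂ * d) with hℓ
  have hmb : ∀ᶠ t in 𝓝[>] (0 : ℝ), (μH[1] (Aset C r₀ e e₁ e₂ t)).toReal / t ≤ ℓ + 1 :=
    hm.eventually (eventually_le_nhds (by linarith))
  have est : ∀ ε > 0, ∀ᶠ t in 𝓝[>] (0 : ℝ),
      |(∫ r in Aset C r₀ e e₁ e₂ t, f (normalMap2 C r) ∂μH[1]) / t -
        f e₁ * ((μH[1] (Aset C r₀ e e₁ e₂ t)).toReal / t)| ≤ ε * (ℓ + 1) := by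
    intro ε hε
    obtain ⟨δ, hδ, hfδ⟩ := Metric.continuousAt_iff.1 (f.continuous.continuousAt (x := e₁)) ε hε
    filter_upwards [hmb, h.finite, h.nearA (δ / 2) (half_pos hδ), self_mem_nhdsWithin]
      with t h1 hfin hn ht0
    have ht0 : 0 < t := ht0
    have hb := norm_setIntegral_le_of_norm_le_const (μ := μH[1]) (s := Aset C r₀ e e₁ e₂ t)
      (f := fun r => f (normalMap2 C r) - f e₁) (C := ε) hfin (fun r hr => by
        have := hn r hr
        rw [← dist_eq_norm] at this
        have := hfδ (lt_of_le_of_lt this (by linarith))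
        rw [dist_eq_norm] at this
        exact this.le)
    rw [integral_sub (h.integ f hfin) (integrableOn_const hfin.ne), setIntegral_const,
      Measure.real, smul_eq_mul, Real.norm_eq_abs] at hb
    have e1 : (∫ r in Aset C r₀ e e₁ e₂ t, f (normalMap2 C r) ∂μH[1]) / t -
        f e₁ * ((μH[1] (Aset C r₀ e e₁ e₂ t)).toReal / t) =
        ((∫ r in Aset C r₀ e e₁ e₂ t, f (normalMap2 C r) ∂μH[1]) -
          (μH[1] (Aset C r₀ e e₁ e₂ t)).toReal * f e₁) / t := by ring
    rw [e1, abs_div, abs_of_pos ht0]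
    calc _ ≤ ε * (μH[1] (Aset C r₀ e e₁ e₂ t)).toReal / t := div_le_div_of_nonneg_right hb ht0.le
      _ = ε * ((μH[1] (Aset C r₀ e e₁ e₂ t)).toReal / t) := by ring
      _ ≤ _ := mul_le_mul_of_nonneg_left h1 hε.le
  have hlin : Tendsto (fun ε : ℝ => ε * (ℓ + 1)) (𝓝[>] 0) (𝓝 0) := by
    have : Continuous (fun ε : ℝ => ε * (ℓ + 1)) := by fun_prop
    simpa using (this.tendsto 0).mono_left nhdsWithin_le_nhds
  have hz : Tendsto (fun t => (∫ r in Aset C r₀ e e₁ e₂ t, f (normalMap2 C r) ∂μH[1]) / t -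
        f e₁ * ((μH[1] (Aset C r₀ e e₁ e₂ t)).toReal / t)) (𝓝[>] 0) (𝓝 0) := by
    refine tendsto_of_bounds (F := fun ε => -(ε * (ℓ + 1))) (G := fun ε => ε * (ℓ + 1)) ?_ hlin ?_ ?_
    · simpa using hlin.neg
    · filter_upwards [self_mem_nhdsWithin] with ε hε
      filter_upwards [est ε hε] with t ht using (abs_le.1 ht).1
    · filter_upwards [self_mem_nhdsWithin] with ε hε
      filter_upwards [est ε hε] with t ht using (abs_le.1 ht).2
  have := hz.add (hm.const_mul (f e₁))
  simpa using this

lemma Ctx.disj (h : Ctx C r₀ e₁ e₂ u₁ u₂ e l₁ l₂ d) :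
    ∀ᶠ t : ℝ in 𝓝[>] 0, Disjoint (Aset C r₀ e e₁ e₂ t) (Aset C r₀ e e₂ e₁ t) := by
  have hpos : 0 < ‖e₁ - e₂‖ := norm_pos_iff.2 (sub_ne_zero.2 h.fr.ne)
  filter_upwards [h.nearA (‖e₁ - e₂‖ / 3) (by positivity),
    h.symm.nearA (‖e₁ - e₂‖ / 3) (by positivity)] with t h1 h2
  rw [Set.disjoint_left]
  intro r a b
  have b1 := h1 r a
  have b2 := h2 r b
  have := norm_sub_le_norm_sub_add_norm_sub e₁ (normalMap2 C r) e₂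
  rw [norm_sub_rev e₁ (normalMap2 C r)] at this
  linarith

lemma Ctx.weak (h : Ctx C r₀ e₁ e₂ u₁ u₂ e l₁ l₂ d) :
    WeaklyTendsto2 (nuT2 C r₀ e)
      (ENNReal.ofReal l₁ • Measure.dirac e₁ + ENNReal.ofReal l₂ • Measure.dirac e₂) := by
  intro f
  have hd := h.fr.dpos
  have h1 := h.l1
  have h2 := h.l2
  have hR : ∫ x, f x ∂(ENNReal.ofReal l₁ • Measure.dirac e₁ + ENNReal.ofReal l₂ • Measure.dirac e₂)
      = l₁ * f e₁ + l₂ * f e₂ := by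
    rw [integral_add_measure ((f.integrable _).smul_measure ENNReal.ofReal_ne_top)
      ((f.integrable _).smul_measure ENNReal.ofReal_ne_top), integral_smul_measure,
      integral_smul_measure, integral_dirac, integral_dirac, ENNReal.toReal_ofReal h1.le,
      ENNReal.toReal_ofReal h2.le, smul_eq_mul, smul_eq_mul]
  rw [hR]
  have hlim := ((h.limI f).add (h.symm.limI f)).div h.limB (by positivity)
  have hval : (f e₁ * (1 / (l₂ * d)) + f e₂ * (1 / (l₁ * d))) / (1 / (l₁ * l₂ * d)) =
      l₁ * f e₁ + l₂ * f e₂ := by field_simp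
  rw [hval] at hlim
  refine hlim.congr' ?_
  filter_upwards [h.disj, h.finite, h.symm.finite, self_mem_nhdsWithin] with t hdis hf1 hf2 ht0
  have ht0 : 0 < t := ht0
  have hunion : Sset2 C r₀ e t ∩ {r : E2 | IsRegularPt2 C r} =
      Aset C r₀ e e₁ e₂ t ∪ Aset C r₀ e e₂ e₁ t := by
    rw [Aset, Aset, ← inter_union_distrib_left]
    refine (inter_eq_left.2 ?_).symm
    intro r _
    exact le_total ⟪r - r₀, e₂⟫ ⟪r - r₀, e₁⟫
  have haem : AEMeasurable (normalMap2 C)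
      (μH[1].restrict (Sset2 C r₀ e t ∩ {r : E2 | IsRegularPt2 C r})) :=
    ((continuousOn_normalMap C).mono inter_subset_right).aemeasurable (h.measS t)
  rw [nuT2, integral_smul_measure, integral_map haem f.continuous.aestronglyMeasurable, hunion,
    setIntegral_union hdis (h.symm.measA t) (h.integ f hf1) (h.symm.integ f hf2),
    ENNReal.toReal_inv, smul_eq_mul]
  simp only [Pi.div_apply]
  field_simp

end

/-- **Remark 1 of the paper (2D case), measure form.** For a planar convex body with a
singular boundary point, `ν_t` weakly converges as `t → 0⁺` to
`(sin β / sin(α+β)) δ_{e₁} + (sin α / sin(α+β)) δ_{e₂} = λ₁ δ_{e₁} + λ₂ δ_{e₂}`,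
where `α = ∠(e₁,e)` and `β = ∠(e₂,e)`. -/
theorem nuT2_tendsto_two_atoms
    (C : Set E2) (r₀ e₁ e₂ e : E2) (lam₁ lam₂ : ℝ)
    (hC : IsConvexBody2 C) (hr₀ : r₀ ∈ frontier C)
    (he₁ : ‖e₁‖ = 1) (he₂ : ‖e₂‖ = 1) (hne : e₁ ≠ e₂) (hne' : e₁ ≠ -e₂)
    (hcone : tanCone2 C r₀ = angleCone e₁ e₂)
    (hl₁ : 0 < lam₁) (hl₂ : 0 < lam₂) (he : e = lam₁ • e₁ + lam₂ • e₂) (hnorm : ‖e‖ = 1) :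
    lam₁ = Real.sin (InnerProductGeometry.angle e₂ e) /
      Real.sin (InnerProductGeometry.angle e₁ e + InnerProductGeometry.angle e₂ e) ∧
    lam₂ = Real.sin (InnerProductGeometry.angle e₁ e) /
      Real.sin (InnerProductGeometry.angle e₁ e + InnerProductGeometry.angle e₂ e) ∧
    WeaklyTendsto2 (nuT2 C r₀ e)
      (ENNReal.ofReal lam₁ • Measure.dirac e₁ + ENNReal.ofReal lam₂ • Measure.dirac e₂) := by
  obtain ⟨u₁, u₂, d, fr, hu, hd2⟩ := exists_frame e₁ e₂ e lam₁ lam₂ he₁ he₂ hne hne' he hnorm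
  have ctx := mk_ctx hC hr₀ hcone fr hl₁ hl₂ he hu
  obtain ⟨a1, a2⟩ := angle_part e₁ e₂ e lam₁ lam₂ d he₁ he₂ hl₁ hl₂ fr.dpos hd2 he hnorm
  exact ⟨a1, a2, ctx.weak⟩
end
end

section
/- Let M > 0 and let 𝒰_M be the class of concave continuous functions u : [0,1] → [0,M] with u(0) = M. Then the minimum of the integral ∫₀¹ (1 + u′(x)²)^{-1} dx over 𝒰_M is attained, and the minimizer is: u_*(x) = min{M, 1 − x} if 0 < M < 1, and u_*(x) = M(1 − x) if M ≥ 1. -/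
open MeasureTheory Set Filter Topology

noncomputable section

attribute [local instance] Classical.propDecidable

/-- The class `𝒰_M` of concave continuous functions `u : [0,1] → [0,M]` with `u(0) = M`. -/
def InUM (M : ℝ) (u : ℝ → ℝ) : Prop :=
  ContinuousOn u (Icc 0 1) ∧ ConcaveOn ℝ (Icc 0 1) u ∧
    (∀ x ∈ Icc (0 : ℝ) 1, u x ∈ Icc 0 M) ∧ u 0 = M

/-- The 1-dimensional resistance `∫₀¹ (1 + u′(x)²)⁻¹ dx`. -/
def res1 (u : ℝ → ℝ) : ℝ := ∫ x in (0 : ℝ)..1, (1 + deriv u x ^ 2)⁻¹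

lemma InUM.anti {M : ℝ} {u : ℝ → ℝ} (h : InUM M u) : AntitoneOn u (Icc 0 1) := by
  obtain ⟨-, hc, hb, h0⟩ := h
  intro x hx y hy hxy
  have h1 := hc.min_le_of_mem_Icc (x := 0) (y := y) (z := x) (by simp) hy ⟨hx.1, hxy⟩
  rw [h0, min_eq_right (hb y hy).2] at h1
  exact h1

lemma InUM.lower {M : ℝ} {u : ℝ → ℝ} (h : InUM M u) (a b : ℝ) (hb : 0 ≤ b)
    (hab : ∀ p : ℝ, 0 ≤ p → a - b * p ≤ (1 + p ^ 2)⁻¹) : a - b * M ≤ res1 u := by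
  have hanti := h.anti
  have hm : MonotoneOn (-u) (uIcc (0:ℝ) 1) := by
    rw [uIcc_of_le zero_le_one]; exact hanti.neg
  have hi := hm.intervalIntegrable_deriv
  have hv := hm.intervalIntegral_deriv_mem_uIcc
  have hd : deriv (-u) = fun x => - deriv u x := by
    funext x; exact deriv.neg
  have hle : -u 0 ≤ -u 1 := neg_le_neg (hanti (by simp) (by simp) zero_le_one)
  rw [uIcc_of_le (by simpa using hle)] at hv
  rw [hd] at hi hv
  have hv2 : ∫ x in (0:ℝ)..1, - deriv u x ≤ M := by
    have h1 := (h.2.2.1 1 (by simp)).1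
    have h0 := h.2.2.2
    have := hv.2
    simp only [Pi.neg_apply] at this
    linarith
  have hii : IntervalIntegrable (fun x => (1 + deriv u x ^ 2)⁻¹) volume 0 1 := by
    refine (intervalIntegrable_const (c := (1:ℝ))).mono_fun ?_ ?_
    · exact (((measurable_deriv u).pow_const 2).const_add 1).inv.aestronglyMeasurable
    · refine Eventually.of_forall fun x => ?_
      have : (0:ℝ) ≤ deriv u x ^ 2 := sq_nonneg _
      simp only [norm_one, Real.norm_eq_abs]
      rw [abs_of_nonneg (by positivity)]
      exact inv_le_one_of_one_le₀ (by linarith)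
  have hlin : IntervalIntegrable (fun x => a - b * (- deriv u x)) volume 0 1 :=
    intervalIntegrable_const.sub (hi.const_mul b)
  have hmono : ∫ x in (0:ℝ)..1, (a - b * (- deriv u x)) ≤ res1 u := by
    refine intervalIntegral.integral_mono_on_of_le_Ioo zero_le_one hlin hii fun x hx => ?_
    have hp : 0 ≤ - deriv u x := by
      have := hanti.derivWithin_nonpos (x := x)
      rw [derivWithin_of_mem_nhds (Icc_mem_nhds hx.1 hx.2)] at this
      linarith
    simpa using hab _ hp
  rw [intervalIntegral.integral_sub intervalIntegrable_const (hi.const_mul b),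
    intervalIntegral.integral_const_mul] at hmono
  simp only [intervalIntegral.integral_const, sub_zero, one_smul] at hmono
  nlinarith [mul_le_mul_of_nonneg_left hv2 hb]

lemma concave_lin (c : ℝ) : ConcaveOn ℝ (Icc (0:ℝ) 1) (fun x => c * (1 - x)) := by
  refine ⟨convex_Icc 0 1, fun x _ y _ a b _ _ hab => le_of_eq ?_⟩
  simp only [smul_eq_mul]
  linear_combination c * hab

/-- **The modified 2D problem (12) of the paper.** The minimum of
`∫₀¹ (1 + u′²)⁻¹ dx` over the class `𝒰_M` is attained at `u_*`, where
`u_*(x) = min{M, 1 − x}` if `0 < M < 1` and `u_*(x) = M(1 − x)` if `M ≥ 1`. -/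
theorem one_dim_newton_minimizer (M : ℝ) (hM : 0 < M) :
    let ustar : ℝ → ℝ := fun x => if M < 1 then min M (1 - x) else M * (1 - x)
    InUM M ustar ∧ ∀ u : ℝ → ℝ, InUM M u → res1 ustar ≤ res1 u := by
  intro ustar
  by_cases h1 : M < 1
  · have hu : ustar = fun x => min M (1 - x) := by
      funext x; simp [ustar, h1]
    rw [hu]
    refine ⟨⟨by fun_prop, ?_, ?_, ?_⟩, fun u hu => ?_⟩
    · have := (concaveOn_const M (convex_Icc (0:ℝ) 1)).inf (concave_lin 1)
      simp only [one_mul] at this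
      exact this
    · intro x hx
      exact ⟨le_min hM.le (by linarith [hx.2]), min_le_left _ _⟩
    · simp [h1.le]
    · have key := hu.lower 1 (1/2) (by norm_num) (fun p hp => by
        rw [← one_div, le_div_iff₀ (by positivity)]
        nlinarith [mul_nonneg hp (sq_nonneg (p - 1))])
      refine le_trans (le_of_eq ?_) key
      have e1 : EqOn (fun x => (1 + deriv (fun x => min M (1 - x)) x ^ 2)⁻¹)
          (fun _ => (1:ℝ)) (Ioo 0 (1 - M)) := by
        intro x hx
        have : (fun x => min M (1 - x)) =ᶠ[𝓝 x] fun _ => M := by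
          filter_upwards [Iio_mem_nhds hx.2] with y hy
          exact min_eq_left (by linarith [mem_Iio.1 hy])
        simp [this.deriv_eq]
      have e2 : EqOn (fun x => (1 + deriv (fun x => min M (1 - x)) x ^ 2)⁻¹)
          (fun _ => (1/2:ℝ)) (Ioo (1 - M) 1) := by
        intro x hx
        have : (fun x => min M (1 - x)) =ᶠ[𝓝 x] fun y => 1 - y := by
          filter_upwards [Ioi_mem_nhds hx.1] with y hy
          exact min_eq_right (by linarith [mem_Ioi.1 hy])
        have hd : deriv (fun y : ℝ => 1 - y) x = -1 := by simp
        simp only [this.deriv_eq, hd]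
        norm_num
      have l1 : (0:ℝ) ≤ 1 - M := by linarith
      have l2 : 1 - M ≤ (1:ℝ) := by linarith
      unfold res1
      rw [← intervalIntegral.integral_add_adjacent_intervals (b := 1 - M),
        intervalIntegral.integral_congr_Ioo_of_le l1 e1,
        intervalIntegral.integral_congr_Ioo_of_le l2 e2]
      · simp only [intervalIntegral.integral_const, smul_eq_mul]
        ring
      · refine (intervalIntegrable_const (c := (1:ℝ))).congr_uIoo ?_
        rw [uIoo_of_le l1]; exact e1.symm
      · refine (intervalIntegrable_const (c := (1/2:ℝ))).congr_uIoo ?_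
        rw [uIoo_of_le l2]; exact e2.symm
  · have hu : ustar = fun x => M * (1 - x) := by
      funext x; simp [ustar, h1]
    rw [hu]
    push Not at h1
    refine ⟨⟨by fun_prop, concave_lin M, ?_, by simp⟩, fun u hu => ?_⟩
    · intro x hx
      constructor <;> nlinarith [hx.1, hx.2]
    · have key := hu.lower ((1 + M^2)⁻¹ + 2 * M / (1 + M^2)^2 * M) (2 * M / (1 + M^2)^2)
        (by positivity) (fun p hp => by
          rw [← sub_nonneg]
          have : (1 + p^2)⁻¹ - ((1 + M^2)⁻¹ + 2 * M / (1 + M^2)^2 * M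
              - 2 * M / (1 + M^2)^2 * p)
              = (p - M)^2 * (2 * M * p + (M^2 - 1)) / ((1 + p^2) * (1 + M^2)^2) := by
            field_simp
            ring
          rw [this]
          have : 0 ≤ M^2 - 1 := by nlinarith
          positivity)
      refine le_trans (le_of_eq ?_) key
      have hd : deriv (fun x => M * (1 - x)) = fun _ => -M := by
        funext x
        simp
      unfold res1
      rw [hd]
      simp
end
end
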